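/- An integral domain D is t-sharp if and only if the ring D[X]_{N_v} is sharp, where N_v = {f ∈ D[X] \ {0} | c(f)_v = D} and c(f) denotes the ideal of D generated by the coefficients of f. -/

import Mathlib

open scoped nonZeroDivisors

/-- A sharp domain: whenever `I ⊇ A·B` for nonzero ideals `I, A, B` of `R`, there
exist ideals `A' ⊇ A` and `B' ⊇ B` with `I = A'·B'`. -/
def IsSharpDomain (R : Type*) [CommRing R] [IsDomain R] : Prop :=
  ∀ I A B : Ideal R, I ≠ 0 → A ≠ 0 → B ≠ 0 → A * B ≤ I →
    ∃ A' B' : Ideal R, A ≤ A' ∧ B ≤ B' ∧ I = A' * B'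

/-- The content `c(f)` of a polynomial: the ideal generated by its coefficients. -/
def polyContent {R : Type*} [CommRing R] (f : Polynomial R) : Ideal R :=
  Ideal.span (Set.range f.coeff)

section StarSharpDefs

variable {D K : Type*} [CommRing D] [IsDomain D] [Field K] [Algebra D K] [IsFractionRing D K]

/-- `D` is sharp with respect to the operation `star` ("`*`-sharp"): whenever
`I ⊇ A·B` for nonzero ideals `I, A, B` of `D`, there exist nonzero ideals `H, J`
with `I* = (HJ)*`, `H* ⊇ A` and `J* ⊇ B`. -/
def IsSharpOp (star : FractionalIdeal D⁰ K → FractionalIdeal D⁰ K) : Prop :=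
  ∀ I A B : Ideal D, I ≠ 0 → A ≠ 0 → B ≠ 0 → A * B ≤ I →
    ∃ H J : Ideal D, H ≠ 0 ∧ J ≠ 0 ∧
      star (I : FractionalIdeal D⁰ K) =
        star ((H : FractionalIdeal D⁰ K) * (J : FractionalIdeal D⁰ K)) ∧
      (A : FractionalIdeal D⁰ K) ≤ star (H : FractionalIdeal D⁰ K) ∧
      (B : FractionalIdeal D⁰ K) ≤ star (J : FractionalIdeal D⁰ K)

lemma inv_ne_zero' {I : FractionalIdeal D⁰ K} (hI : I ≠ 0) : I⁻¹ ≠ 0 := by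
  obtain ⟨d, hd, hdI⟩ := I.isFractional
  have hmem : algebraMap D K d ∈ I⁻¹ := by
    rw [FractionalIdeal.mem_inv_iff hI]
    intro y hy
    obtain ⟨c, hc⟩ := hdI y hy
    refine ⟨c, trivial, ?_⟩
    simpa [Algebra.smul_def] using hc
  intro h0
  rw [h0] at hmem
  have : algebraMap D K d ≠ 0 :=
    IsFractionRing.to_map_ne_zero_of_mem_nonZeroDivisors hd
  exact this (by simpa using hmem)

/-- The `v`-operation `I ↦ I_v = (I⁻¹)⁻¹`. -/
noncomputable def vOp (I : FractionalIdeal D⁰ K) : FractionalIdeal D⁰ K := (I⁻¹)⁻¹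

lemma vOp_mono {I J : FractionalIdeal D⁰ K} (h : I ≤ J) : vOp I ≤ vOp J := by
  rcases eq_or_ne I 0 with rfl | hI
  · show ((0 : FractionalIdeal D⁰ K)⁻¹)⁻¹ ≤ vOp J
    rw [FractionalIdeal.inv_zero', FractionalIdeal.inv_zero']
    exact FractionalIdeal.zero_le _
  have hJ : J ≠ 0 := fun hJ0 => hI (le_antisymm (hJ0 ▸ h) (FractionalIdeal.zero_le I))
  exact FractionalIdeal.inv_anti_mono (inv_ne_zero' hJ) (inv_ne_zero' hI)
    (FractionalIdeal.inv_anti_mono hI hJ h)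

/-- The `t`-operation: `I_t` is the union of `H_v` over the finitely generated
subideals `H` of `I`. -/
noncomputable def tOp (I : FractionalIdeal D⁰ K) : FractionalIdeal D⁰ K :=
  ⟨⨆ J : {J : FractionalIdeal D⁰ K // (J : Submodule D K).FG ∧ J ≤ I},
      ((vOp (J : FractionalIdeal D⁰ K) : FractionalIdeal D⁰ K) : Submodule D K),
    FractionalIdeal.isFractional_of_le (J := vOp I)
      (iSup_le fun J => FractionalIdeal.coe_le_coe.2 (vOp_mono J.2.2))⟩

end StarSharpDefs

section DivisibilityClosure

variable {D : Type*} [CommRing D]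

/-- `z` lies in the `v`-closure of the ideal generated by `S`, phrased through divisibility:
every fraction `p / q` multiplying `S` into `D` multiplies `z` into `D`. -/
def InVClosure (S : Set D) (z : D) : Prop :=
  ∀ p q : D, q ≠ 0 → (∀ y ∈ S, q ∣ p * y) → q ∣ p * z

/-- `z` lies in the `t`-closure of `I`, i.e. in the `v`-closure of a finite subset of `I`. -/
def InTClosure (I : Ideal D) (z : D) : Prop :=
  ∃ S : Finset D, (S : Set D) ⊆ I ∧ InVClosure (S : Set D) z

lemma InVClosure.of_subset_span {S T : Set D} {z : D} (h : InVClosure S z)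
    (hST : S ⊆ (Ideal.span T : Ideal D)) : InVClosure T z := by
  intro p q hq hT
  refine h p q hq fun y hy => ?_
  have hle : Ideal.span T ≤ Submodule.comap (LinearMap.mulLeft D p) (Ideal.span {q}) := by
    rw [Ideal.span_le]
    intro t ht
    simpa [Ideal.mem_span_singleton] using hT t ht
  simpa [Ideal.mem_span_singleton] using hle (hST hy)

lemma InVClosure.mono {S T : Set D} {z : D} (h : InVClosure S z) (hST : S ⊆ T) :
    InVClosure T z :=
  h.of_subset_span (hST.trans Ideal.subset_span)

lemma InVClosure.of_mem {S : Set D} {z : D} (h : z ∈ S) : InVClosure S z :=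
  fun _ _ _ hS => hS z h

lemma InTClosure.of_mem {I : Ideal D} {z : D} (h : z ∈ I) : InTClosure I z :=
  ⟨{z}, by simpa using h, InVClosure.of_mem (by simp)⟩

lemma InTClosure.trans {I J : Ideal D} (hIJ : ∀ x ∈ I, InTClosure J x) {z : D}
    (h : InTClosure I z) : InTClosure J z := by
  classical
  obtain ⟨S, hS, hz⟩ := h
  have hS' : ∀ s : S, ∃ T : Finset D, (T : Set D) ⊆ J ∧ InVClosure (T : Set D) (s : D) :=
    fun s => hIJ s (hS s.2)
  choose T hTJ hT using hS'
  refine ⟨Finset.univ.biUnion T, by simpa using hTJ, fun p q hq h => hz p q hq fun s hs => ?_⟩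
  refine hT ⟨s, hs⟩ p q hq fun y hy => h y ?_
  simpa using ⟨s, hs, hy⟩

/-- If `I * J` is contained in a principal ideal, so is `I_t * J`. -/
lemma InTClosure.dvd_mul {I : Ideal D} {a l z : D} (ha : a ≠ 0) (hz : InTClosure I z)
    (h : ∀ y ∈ I, a ∣ l * y) : a ∣ l * z := by
  obtain ⟨S, hS, hSz⟩ := hz
  exact hSz l a ha fun y hy => h y (hS hy)

lemma InTClosure.dvd {a z : D} (ha : a ≠ 0) (hz : InTClosure (Ideal.span {a}) z) : a ∣ z := by
  simpa using hz.dvd_mul (l := 1) ha fun y hy => by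
    simpa [Ideal.mem_span_singleton] using hy

end DivisibilityClosure

lemma algebraMap_div_mul_eq_iff_dvd {D K : Type*} [CommRing D] [Field K] [Algebra D K]
    [IsFractionRing D K] {p q y : D} (hq : q ≠ 0) :
    (∃ c, algebraMap D K c = algebraMap D K p / algebraMap D K q * algebraMap D K y) ↔
      q ∣ p * y := by
  have hq' : algebraMap D K q ≠ 0 := by simpa using hq
  constructor
  · rintro ⟨c, hc⟩
    refine ⟨c, IsFractionRing.injective D K ?_⟩
    rw [map_mul, map_mul, hc]
    field_simp
  · rintro ⟨c, hc⟩
    refine ⟨c, ?_⟩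
    have := congrArg (algebraMap D K) hc
    rw [map_mul, map_mul] at this
    field_simp
    rw [this, mul_comm]

section ClosureOperations

variable {D K : Type*} [CommRing D] [IsDomain D] [Field K] [Algebra D K] [IsFractionRing D K]

lemma mem_vOp_coeIdeal_iff {F : Ideal D} (hF : F ≠ 0) {z : K} :
    z ∈ vOp (F : FractionalIdeal D⁰ K) ↔
      ∃ d, algebraMap D K d = z ∧ InVClosure (F : Set D) d := by
  have hF' : (F : FractionalIdeal D⁰ K) ≠ 0 := by simpa using hF
  have key : ∀ x : K, x ∈ (F : FractionalIdeal D⁰ K)⁻¹ ↔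
      ∀ y ∈ F, ∃ c, algebraMap D K c = x * algebraMap D K y := by
    intro x
    rw [FractionalIdeal.mem_inv_iff hF']
    simp only [FractionalIdeal.mem_coeIdeal, FractionalIdeal.mem_one_iff]
    exact ⟨fun h y hy => h _ ⟨y, hy, rfl⟩, by rintro h _ ⟨y, hy, rfl⟩; exact h y hy⟩
  rw [vOp, FractionalIdeal.mem_inv_iff (inv_ne_zero' hF')]
  simp only [key, FractionalIdeal.mem_one_iff]
  constructor
  · intro h
    obtain ⟨d, hd⟩ := h 1 fun y _ => ⟨y, by simp⟩
    rw [mul_one] at hd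
    refine ⟨d, hd, fun p q hq hpq => ?_⟩
    rw [← algebraMap_div_mul_eq_iff_dvd (K := K) hq, hd, mul_comm]
    exact h _ fun y hy => (algebraMap_div_mul_eq_iff_dvd hq).2 (hpq y hy)
  · rintro ⟨d, rfl, hd⟩ x hx
    obtain ⟨p, q, hq, rfl⟩ := IsFractionRing.div_surjective (A := D) x
    have hq' : q ≠ 0 := nonZeroDivisors.ne_zero hq
    rw [mul_comm]
    exact (algebraMap_div_mul_eq_iff_dvd hq').2
      (hd p q hq' fun y hy => (algebraMap_div_mul_eq_iff_dvd hq').1 (hx y hy))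

lemma mem_tOp_iff {I : FractionalIdeal D⁰ K} {z : K} :
    z ∈ tOp I ↔ ∃ J : FractionalIdeal D⁰ K, (J : Submodule D K).FG ∧ J ≤ I ∧ z ∈ vOp J := by
  have : Nonempty {J : FractionalIdeal D⁰ K // (J : Submodule D K).FG ∧ J ≤ I} :=
    ⟨⟨0, by simpa using Submodule.fg_bot, FractionalIdeal.zero_le _⟩⟩
  change z ∈ ⨆ J : {J : FractionalIdeal D⁰ K // (J : Submodule D K).FG ∧ J ≤ I},
      ((vOp (J : FractionalIdeal D⁰ K) : FractionalIdeal D⁰ K) : Submodule D K) ↔ _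
  rw [Submodule.mem_iSup_of_directed]
  · simp [and_assoc]
  · rintro ⟨J₁, h₁, h₁'⟩ ⟨J₂, h₂, h₂'⟩
    refine ⟨⟨J₁ ⊔ J₂, ?_, sup_le h₁' h₂'⟩, ?_, ?_⟩
    · rw [FractionalIdeal.coe_sup]
      exact h₁.sup h₂
    · exact FractionalIdeal.coe_le_coe.2 (vOp_mono le_sup_left)
    · exact FractionalIdeal.coe_le_coe.2 (vOp_mono le_sup_right)

lemma mem_tOp_coeIdeal_iff {I : Ideal D} (hI : I ≠ 0) {z : K} :
    z ∈ tOp (I : FractionalIdeal D⁰ K) ↔ ∃ d, algebraMap D K d = z ∧ InTClosure I d := by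
  classical
  rw [mem_tOp_iff]
  constructor
  · rintro ⟨J, hJ, hJI, hz⟩
    obtain ⟨F, rfl⟩ := FractionalIdeal.le_one_iff_exists_coeIdeal.1
      (hJI.trans FractionalIdeal.coeIdeal_le_one)
    rw [FractionalIdeal.coeIdeal_fg _ (IsFractionRing.injective D K)] at hJ
    rw [FractionalIdeal.coeIdeal_le_coeIdeal] at hJI
    by_cases hF : F = 0
    · subst hF
      refine ⟨0, ?_, InTClosure.of_mem I.zero_mem⟩
      simpa [vOp, FractionalIdeal.inv_zero', eq_comm] using hz
    obtain ⟨d, rfl, hd⟩ := (mem_vOp_coeIdeal_iff hF).1 hz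
    obtain ⟨S, rfl⟩ := hJ
    exact ⟨d, rfl, S, fun s hs => hJI (Submodule.subset_span hs),
      hd.of_subset_span subset_rfl⟩
  · rintro ⟨d, rfl, S, hS, hd⟩
    obtain ⟨y, hy, hy0⟩ := Submodule.exists_mem_ne_zero_of_ne_bot hI
    refine ⟨(Ideal.span (insert y S : Set D) : Ideal D), ?_, ?_, ?_⟩
    · rw [FractionalIdeal.coeIdeal_fg _ (IsFractionRing.injective D K)]
      exact ⟨insert y S, by simp⟩
    · rw [FractionalIdeal.coeIdeal_le_coeIdeal, Ideal.span_le]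
      exact Set.insert_subset hy hS
    · refine (mem_vOp_coeIdeal_iff ?_).2
        ⟨d, rfl, hd.mono ((Set.subset_insert _ _).trans Ideal.subset_span)⟩
      intro h
      have : y ∈ Ideal.span (insert y S : Set D) := Ideal.subset_span (Set.mem_insert _ _)
      rw [h] at this
      exact hy0 (by simpa using this)

lemma algebraMap_mem_tOp_coeIdeal_iff {I : Ideal D} (hI : I ≠ 0) {d : D} :
    algebraMap D K d ∈ tOp (I : FractionalIdeal D⁰ K) ↔ InTClosure I d := by
  rw [mem_tOp_coeIdeal_iff hI]
  constructor
  · rintro ⟨e, he, h⟩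
    rwa [← IsFractionRing.injective D K he]
  · exact fun h => ⟨d, rfl, h⟩

lemma coeIdeal_le_tOp_iff {A I : Ideal D} (hI : I ≠ 0) :
    (A : FractionalIdeal D⁰ K) ≤ tOp (I : FractionalIdeal D⁰ K) ↔
      ∀ a ∈ A, InTClosure I a := by
  constructor
  · intro h a ha
    exact (algebraMap_mem_tOp_coeIdeal_iff (K := K) hI).1
      (h ((FractionalIdeal.mem_coeIdeal _).2 ⟨a, ha, rfl⟩))
  · intro h z hz
    obtain ⟨a, ha, rfl⟩ := (FractionalIdeal.mem_coeIdeal _).1 hz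
    exact (algebraMap_mem_tOp_coeIdeal_iff hI).2 (h a ha)

lemma tOp_coeIdeal_eq_iff {I J : Ideal D} (hI : I ≠ 0) (hJ : J ≠ 0) :
    tOp (I : FractionalIdeal D⁰ K) = tOp (J : FractionalIdeal D⁰ K) ↔
      (∀ x ∈ I, InTClosure J x) ∧ ∀ x ∈ J, InTClosure I x := by
  constructor
  · intro h
    refine ⟨fun x hx => ?_, fun x hx => ?_⟩
    · rw [← algebraMap_mem_tOp_coeIdeal_iff (K := K) hJ, ← h, algebraMap_mem_tOp_coeIdeal_iff hI]
      exact InTClosure.of_mem hx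
    · rw [← algebraMap_mem_tOp_coeIdeal_iff (K := K) hI, h, algebraMap_mem_tOp_coeIdeal_iff hJ]
      exact InTClosure.of_mem hx
  · rintro ⟨h₁, h₂⟩
    ext z
    rw [mem_tOp_coeIdeal_iff hI, mem_tOp_coeIdeal_iff hJ]
    exact ⟨fun ⟨d, hd, h⟩ => ⟨d, hd, h.trans h₁⟩, fun ⟨d, hd, h⟩ => ⟨d, hd, h.trans h₂⟩⟩

lemma vOp_polyContent_eq_one_iff {f : Polynomial D} (hf : f ≠ 0) :
    vOp ((polyContent f : Ideal D) : FractionalIdeal D⁰ K) = 1 ↔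
      InVClosure (Set.range f.coeff) 1 := by
  have hF : polyContent f ≠ 0 := by
    intro h
    refine hf (Polynomial.ext fun i => ?_)
    have hi : f.coeff i ∈ polyContent f := Ideal.subset_span ⟨i, rfl⟩
    rw [h] at hi
    simpa using hi
  constructor
  · intro h
    obtain ⟨d, hd, hd'⟩ := (mem_vOp_coeIdeal_iff (K := K) hF).1
      (h ▸ FractionalIdeal.one_mem_one D⁰)
    rw [← map_one (algebraMap D K)] at hd
    rw [← IsFractionRing.injective D K hd]
    exact hd'.of_subset_span subset_rfl
  · intro h
    ext z
    rw [mem_vOp_coeIdeal_iff hF, FractionalIdeal.mem_one_iff]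
    refine exists_congr fun d => and_iff_left ?_
    intro p q hq hd
    exact (h.mono Ideal.subset_span p q hq hd).trans (mul_dvd_mul_left p (one_dvd d))

/-- A form of `t`-sharpness not mentioning the quotient field. -/
lemma isSharpOp_tOp_iff :
    IsSharpOp (D := D) (K := K) tOp ↔
      ∀ I A B : Ideal D, I ≠ 0 → A ≠ 0 → B ≠ 0 → A * B ≤ I →
        ∃ H J : Ideal D, H ≠ 0 ∧ J ≠ 0 ∧ (∀ x ∈ I, InTClosure (H * J) x) ∧
          (∀ x ∈ H * J, InTClosure I x) ∧ (∀ a ∈ A, InTClosure H a) ∧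
          ∀ b ∈ B, InTClosure J b := by
  unfold IsSharpOp
  refine forall₃_congr fun I A B => forall₄_congr fun hI _ _ _ => exists₂_congr fun H J => ?_
  refine and_congr_right fun hH => and_congr_right fun hJ => ?_
  rw [← FractionalIdeal.coeIdeal_mul, tOp_coeIdeal_eq_iff hI (mul_ne_zero hH hJ),
    coeIdeal_le_tOp_iff hH, coeIdeal_le_tOp_iff hJ, and_assoc]

end ClosureOperations

section Content

open Polynomial

variable {D : Type*} [CommRing D]

/-- The content of `f` is `t`-invertible: its `t`-inverse is generated by the fractions `b / a`,
for `b` a coefficient of some polynomial `g`. -/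
def HasTInverse (f : D[X]) : Prop :=
  ∃ a : D, ∃ g : D[X], a ≠ 0 ∧ g ≠ 0 ∧ (∀ i j, a ∣ f.coeff i * g.coeff j) ∧
    InVClosure {y | ∃ i j, y = f.coeff i * g.coeff j} a

lemma exists_polynomial_coeff (S : Finset D) :
    ∃ f : D[X], Set.range f.coeff ⊆ insert 0 (S : Set D) ∧ (S : Set D) ⊆ Set.range f.coeff := by
  classical
  induction S using Finset.induction_on with
  | empty => exact ⟨0, by rintro _ ⟨i, rfl⟩; simp, by simp⟩
  | insert s S _ ih =>
    obtain ⟨f, hf, hSf⟩ := ih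
    refine ⟨X * f + C s, ?_, ?_⟩
    · rintro _ ⟨i, rfl⟩
      cases i with
      | zero => simp
      | succ i =>
        have := hf ⟨i, rfl⟩
        simp only [Set.mem_insert_iff, Finset.mem_coe] at this
        simp only [coeff_add, coeff_X_mul, coeff_C_succ, add_zero, Finset.coe_insert,
          Set.mem_insert_iff, Finset.mem_coe]
        tauto
    · rw [Finset.coe_insert]
      refine Set.insert_subset ⟨0, by simp⟩ fun y hy => ?_
      obtain ⟨i, rfl⟩ := hSf hy
      exact ⟨i + 1, by simp⟩

variable [IsDomain D]

lemma exists_maximal_nat {p : ℕ → Prop} {n i : ℕ} (hi : p i) (hn : ∀ k, p k → k ≤ n) :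
    ∃ m, p m ∧ ∀ k, m < k → ¬ p k :=
  ⟨sSup {k | p k}, Nat.sSup_mem ⟨i, hi⟩ ⟨n, fun k hk => hn k hk⟩,
    fun _ hk => notMem_of_csSup_lt hk ⟨n, fun k hk => hn k hk⟩⟩

/-- A fractional Gauss lemma: the products of coefficients of `f` and `g`, divided by `a`, lie in
the radical of the content of `f * g / a`. -/
lemma mem_radical_span_coeff {f g h : D[X]} {a : D} (ha : a ≠ 0) (hfg : f * g = C a * h)
    {e : ℕ → ℕ → D} (he : ∀ i j, f.coeff i * g.coeff j = a * e i j) (i j : ℕ) :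
    e i j ∈ (Ideal.span (Set.range h.coeff)).radical := by
  rw [Ideal.radical_eq_sInf, Submodule.mem_sInf]
  rintro M ⟨hM, hprime⟩
  by_contra hij
  have hle : ∀ i j, e i j ∉ M → i ≤ f.natDegree ∧ j ≤ g.natDegree := by
    intro i j hij
    have hne : f.coeff i * g.coeff j ≠ 0 := by
      rw [he]
      refine mul_ne_zero ha fun h0 => hij ?_
      rw [h0]
      exact M.zero_mem
    exact ⟨le_natDegree_of_ne_zero (left_ne_zero_of_mul hne),
      le_natDegree_of_ne_zero (right_ne_zero_of_mul hne)⟩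
  obtain ⟨m, ⟨j', hmj⟩, hm⟩ := exists_maximal_nat (p := fun i => ∃ j, e i j ∉ M) ⟨j, hij⟩
    fun k ⟨l, hl⟩ => (hle k l hl).1
  obtain ⟨n, hmn, hn⟩ := exists_maximal_nat (p := fun j => e m j ∉ M) hmj
    fun l hl => (hle m l hl).2
  push Not at hm hn
  have hsum : h.coeff (m + n) = ∑ x ∈ Finset.HasAntidiagonal.antidiagonal (m + n), e x.1 x.2 := by
    apply mul_left_cancel₀ ha
    rw [← coeff_C_mul, ← hfg, coeff_mul, Finset.mul_sum]
    exact Finset.sum_congr rfl fun x _ => he _ _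
  have hmem : ∑ x ∈ Finset.HasAntidiagonal.antidiagonal (m + n), e x.1 x.2 ∈ M :=
    hsum ▸ hM (Ideal.subset_span ⟨m + n, rfl⟩)
  rw [← Finset.add_sum_erase _ _ (Finset.HasAntidiagonal.mem_antidiagonal.2 (rfl : (m, n).1 + (m, n).2 = m + n))]
    at hmem
  refine hmn ((Ideal.add_mem_iff_left M (M.sum_mem fun x hx => ?_)).1 hmem)
  obtain ⟨k, l⟩ := x
  simp only [Finset.mem_erase, ne_eq, Prod.mk.injEq, not_and, Finset.HasAntidiagonal.mem_antidiagonal] at hx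
  obtain ⟨hne, hkl⟩ := hx
  rcases lt_trichotomy m k with hk | rfl | hk
  · exact hm k hk l
  · exact absurd (by omega) (hne rfl)
  · have hcross : e k l * e m n = e m l * e k n := by
      apply mul_left_cancel₀ (mul_ne_zero ha ha)
      linear_combination (-(a * e m n)) * he k l - (f.coeff k * g.coeff l) * he m n +
        (a * e k n) * he m l + (f.coeff m * g.coeff l) * he k n
    refine (hprime.mem_or_mem (?_ : e k l * e m n ∈ M)).resolve_right hmn
    rw [hcross]
    exact Ideal.mul_mem_right _ M (hn l (by omega))

lemma inVClosure_coeff_one {f g h : D[X]} {a : D} (ha : a ≠ 0) (hfg : f * g = C a * h)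
    (hdvd : ∀ i j, a ∣ f.coeff i * g.coeff j)
    (hv : InVClosure {y | ∃ i j, y = f.coeff i * g.coeff j} a) :
    InVClosure (Set.range h.coeff) 1 := by
  classical
  choose e he using hdvd
  let P : Ideal D := Ideal.span (Set.range fun x : ℕ × ℕ => e x.1 x.2)
  have heP : ∀ i j, e i j ∈ P := fun i j => Ideal.subset_span ⟨(i, j), rfl⟩
  have hPfg : P.FG := by
    refine ⟨(((f.support ×ˢ g.support).image fun x => e x.1 x.2)), le_antisymm ?_ ?_⟩
    · refine Ideal.span_le.2 fun y hy => ?_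
      obtain ⟨x, -, rfl⟩ := Finset.mem_image.1 hy
      exact heP _ _
    · refine Ideal.span_le.2 ?_
      rintro _ ⟨⟨i, j⟩, rfl⟩
      by_cases h0 : f.coeff i * g.coeff j = 0
      · rw [he, mul_eq_zero, or_iff_right ha] at h0
        simp [h0]
      · refine Ideal.subset_span (Finset.mem_image.2 ⟨(i, j), ?_, rfl⟩)
        simpa [not_or] using h0
  obtain ⟨n, hn⟩ := Ideal.exists_pow_le_of_le_radical_of_fg
    (J := Ideal.span (Set.range h.coeff)) (I := P)
    (Ideal.span_le.2 (by rintro _ ⟨x, rfl⟩; exact mem_radical_span_coeff ha hfg he _ _)) hPfg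
  have hcancel : ∀ (n : ℕ) (p q : D), q ≠ 0 → (∀ y ∈ P ^ n, q ∣ p * y) → q ∣ p := by
    intro n
    induction n with
    | zero => exact fun p q _ hp => by simpa using hp 1 (by simp)
    | succ n ih =>
      intro p q hq hp
      refine ih p q hq fun y hy => ?_
      have := hv (p * y) (q * a) (mul_ne_zero hq ha) ?_
      · exact (mul_dvd_mul_iff_right ha).1 this
      · rintro _ ⟨i, j, rfl⟩
        obtain ⟨c, hc⟩ := hp (y * e i j) (by rw [pow_succ]; exact Ideal.mul_mem_mul hy (heP i j))
        exact ⟨c, by rw [he]; linear_combination a * hc⟩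
  have hone : InVClosure ((P ^ n : Ideal D) : Set D) 1 := fun p q hq hp => by
    simpa using hcancel n p q hq hp
  exact hone.of_subset_span hn

end Content

section Extension

open Polynomial

variable {D : Type*} [CommRing D] {N : Submonoid D[X]} {R : Type*} [CommRing R]
  [Algebra D[X] R] [IsLocalization N R]

/-- Contracting the extension to `D[X]_{N_v}` of an ideal of `D` stays inside its `t`-closure. -/
lemma inTClosure_of_mem_map (hN : ∀ h ∈ N, InVClosure (Set.range h.coeff) 1) {I : Ideal D} {d : D}
    (hd : algebraMap D[X] R (C d) ∈ (I.map C).map (algebraMap D[X] R)) : InTClosure I d := by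
  classical
  rw [IsLocalization.algebraMap_mem_map_algebraMap_iff N] at hd
  obtain ⟨h, hh, hmem⟩ := hd
  rw [Ideal.mem_map_C_iff] at hmem
  refine ⟨h.support.image fun i => h.coeff i * d, ?_, fun p q hq hdvd => ?_⟩
  · intro y hy
    obtain ⟨i, -, rfl⟩ := Finset.mem_image.1 hy
    simpa using hmem i
  · rw [← mul_one (p * d)]
    refine hN h hh (p * d) q hq ?_
    rintro _ ⟨i, rfl⟩
    by_cases hi : h.coeff i = 0
    · simp [hi]
    · simpa [mul_assoc, mul_comm d] using hdvd (h.coeff i * d)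
        (Finset.mem_coe.2 (Finset.mem_image.2 ⟨i, by simpa using hi, rfl⟩))

variable [IsDomain D]

lemma algebraMap_C_mem_span (hN : ∀ h : D[X], h ≠ 0 → InVClosure (Set.range h.coeff) 1 → h ∈ N)
    {f : D[X]} (hf : f ≠ 0) (hinv : HasTInverse f) {d : D}
    (hd : InVClosure (Set.range f.coeff) d) :
    algebraMap D[X] R (C d) ∈ Ideal.span {algebraMap D[X] R f} := by
  obtain ⟨a, g, ha, hg, hdvd, hv⟩ := hinv
  have hCa : (C a : D[X]) ≠ 0 := by simpa using ha
  obtain ⟨h, hfg⟩ : C a ∣ f * g := by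
    rw [C_dvd_iff_dvd_coeff]
    intro i
    rw [coeff_mul]
    exact Finset.dvd_sum fun x _ => hdvd _ _
  obtain ⟨g', hg'⟩ : C a ∣ C d * g := by
    rw [C_dvd_iff_dvd_coeff]
    intro j
    rw [coeff_C_mul, mul_comm]
    refine hd (g.coeff j) a ha ?_
    rintro _ ⟨i, rfl⟩
    rw [mul_comm]
    exact hdvd i j
  have hh : h ≠ 0 := by
    rintro rfl
    exact mul_ne_zero hf hg (by simpa using hfg)
  have hu : IsUnit (algebraMap D[X] R h) :=
    IsLocalization.map_units R ⟨h, hN h hh (inVClosure_coeff_one ha hfg hdvd hv)⟩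
  have heq : C d * h = f * g' := by
    apply mul_left_cancel₀ hCa
    linear_combination (-C d) * hfg + f * hg'
  rw [Ideal.mem_span_singleton, ← hu.dvd_mul_right, ← map_mul, heq, map_mul]
  exact dvd_mul_right _ _

lemma mem_map_of_inTClosure (hN : ∀ h : D[X], h ≠ 0 → InVClosure (Set.range h.coeff) 1 → h ∈ N)
    (hinv : ∀ f : D[X], f ≠ 0 → HasTInverse f) {I : Ideal D} (hI : I ≠ 0) {d : D}
    (hd : InTClosure I d) :
    algebraMap D[X] R (C d) ∈ (I.map C).map (algebraMap D[X] R) := by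
  classical
  obtain ⟨S, hS, hd⟩ := hd
  obtain ⟨y, hy, hy0⟩ := Submodule.exists_mem_ne_zero_of_ne_bot hI
  obtain ⟨f, hfS, hSf⟩ := exists_polynomial_coeff (insert y S)
  rw [Finset.coe_insert] at hfS hSf
  have hf : f ≠ 0 := by
    rintro rfl
    obtain ⟨i, hi⟩ := hSf (Set.mem_insert _ _)
    exact hy0 (by simpa using hi.symm)
  have hfI : f ∈ I.map C := Ideal.mem_map_C_iff.2 fun i =>
    Set.insert_subset I.zero_mem (Set.insert_subset hy hS) (hfS ⟨i, rfl⟩)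
  refine (Ideal.span_singleton_le_iff_mem _).2 (Ideal.mem_map_of_mem _ hfI) ?_
  exact algebraMap_C_mem_span hN hf (hinv f hf) (hd.mono ((Set.subset_insert _ _).trans hSf))

/-- If contents are `t`-invertible, every ideal of `D[X]_{N_v}` is extended from `D`. -/
lemma map_comap_eq_self (hN : ∀ h : D[X], h ≠ 0 → InVClosure (Set.range h.coeff) 1 → h ∈ N)
    (hinv : ∀ f : D[X], f ≠ 0 → HasTInverse f) (J : Ideal R) :
    (((J.comap (algebraMap D[X] R)).comap C).map C).map (algebraMap D[X] R) = J := by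
  refine le_antisymm ?_ fun r hr => ?_
  · rw [Ideal.map_le_iff_le_comap, Ideal.map_le_iff_le_comap]
  obtain ⟨f, s, rfl⟩ := IsLocalization.exists_mk'_eq N r
  rw [IsLocalization.mk'_mem_iff] at hr ⊢
  refine Ideal.mem_map_of_mem _ (Ideal.mem_map_C_iff.2 fun i => ?_)
  by_cases hf : f = 0
  · simp [hf]
  exact (Ideal.span_singleton_le_iff_mem _).2 hr
    (algebraMap_C_mem_span hN hf (hinv f hf) (InVClosure.of_mem ⟨i, rfl⟩))

end Extension

section Sharp

open Polynomial

variable {D : Type*} [CommRing D]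

lemma hasTInverse_of_finset {f : D[X]} {a : D} (ha : a ≠ 0) (S : Finset D)
    (hS0 : ∃ s ∈ S, s ≠ 0) (hdvd : ∀ i, ∀ s ∈ S, a ∣ f.coeff i * s)
    (hv : ∀ p q : D, q ≠ 0 → (∀ i, ∀ s ∈ S, q * a ∣ p * (f.coeff i * s)) → q ∣ p) :
    HasTInverse f := by
  obtain ⟨g, hgS, hSg⟩ := exists_polynomial_coeff S
  refine ⟨a, g, ha, ?_, fun i j => ?_, fun p q hq hpq => ?_⟩
  · rintro rfl
    obtain ⟨s, hs, hs0⟩ := hS0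
    obtain ⟨j, hj⟩ := hSg hs
    exact hs0 (by simpa using hj.symm)
  · rcases hgS ⟨j, rfl⟩ with h | h
    · simp [h]
    · exact hdvd i _ h
  · refine hv (p * a) q hq fun i s hs => ?_
    obtain ⟨j, rfl⟩ := hSg hs
    obtain ⟨c, hc⟩ := hpq _ ⟨i, j, rfl⟩
    exact ⟨c, by linear_combination a * hc⟩

/-- Every element of `A * B` lies in `A * L` for some ideal `L` generated by a finite subset
of `B`. -/
lemma exists_finset_forall_mem_mul_span {R : Type*} [CommRing R] {A B : Ideal R} (S : Finset R)
    (hS : (S : Set R) ⊆ (A * B : Ideal R)) :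
    ∃ L : Finset R, (L : Set R) ⊆ B ∧ (S : Set R) ⊆ (A * Ideal.span (L : Set R) : Ideal R) := by
  classical
  have hmono : ∀ L L' : Finset R, L ⊆ L' →
      A * Ideal.span (L : Set R) ≤ A * Ideal.span (L' : Set R) := fun L L' h =>
    Ideal.mul_mono_right (Ideal.span_mono (by exact_mod_cast h))
  have hone : ∀ x ∈ A * B, ∃ L : Finset R, (L : Set R) ⊆ B ∧ x ∈ A * Ideal.span (L : Set R) := by
    intro x hx
    refine Submodule.mul_induction_on hx (fun a ha b hb => ?_) fun x y hx hy => ?_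
    · exact ⟨{b}, by simpa using hb, Ideal.mul_mem_mul ha (Ideal.subset_span (by simp))⟩
    · obtain ⟨L, hL, hx⟩ := hx
      obtain ⟨L', hL', hy⟩ := hy
      refine ⟨L ∪ L', ?_, Ideal.add_mem _ (hmono L _ Finset.subset_union_left hx)
        (hmono L' _ Finset.subset_union_right hy)⟩
      rw [Finset.coe_union]
      exact Set.union_subset hL hL'
  induction S using Finset.induction_on with
  | empty => exact ⟨∅, by simp, by simp⟩
  | insert s S _ ih =>
    rw [Finset.coe_insert, Set.insert_subset_iff] at hS
    obtain ⟨L, hL, hs⟩ := hone s hS.1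
    obtain ⟨L', hL', hS'⟩ := ih hS.2
    refine ⟨L ∪ L', ?_, ?_⟩
    · rw [Finset.coe_union]
      exact Set.union_subset hL hL'
    · rw [Finset.coe_insert]
      exact Set.insert_subset (hmono L _ Finset.subset_union_left hs)
        (hS'.trans (hmono L' _ Finset.subset_union_right))

variable [IsDomain D]

/-- In a `t`-sharp domain, contents are `t`-invertible. -/
lemma hasTInverse_of_tSharp
    (hD : ∀ I A B : Ideal D, I ≠ 0 → A ≠ 0 → B ≠ 0 → A * B ≤ I →
        ∃ H J : Ideal D, H ≠ 0 ∧ J ≠ 0 ∧ (∀ x ∈ I, InTClosure (H * J) x) ∧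
          (∀ x ∈ H * J, InTClosure I x) ∧ (∀ a ∈ A, InTClosure H a) ∧
          ∀ b ∈ B, InTClosure J b)
    {f : D[X]} (hf : f ≠ 0) : HasTInverse f := by
  classical
  let a := f.leadingCoeff
  have ha : a ≠ 0 := leadingCoeff_ne_zero.2 hf
  let B : Ideal D :=
    { carrier := {x | ∀ i, a ∣ f.coeff i * x}
      add_mem' := fun hx hy i => by rw [mul_add]; exact dvd_add (hx i) (hy i)
      zero_mem' := fun i => by simp
      smul_mem' := fun c x hx i => by
        rw [smul_eq_mul, mul_left_comm]
        exact (hx i).mul_left c }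
  have hB : ∀ x, x ∈ B ↔ ∀ i, a ∣ f.coeff i * x := fun _ => Iff.rfl
  have haI : (Ideal.span {a} : Ideal D) ≠ 0 := by simpa using ha
  have hcoeff : ∀ i, f.coeff i ∈ Ideal.span (Set.range f.coeff) :=
    fun i => Ideal.subset_span ⟨i, rfl⟩
  obtain ⟨H, L, hH, hL, hHL, hHL', hAH, hBL⟩ := hD (Ideal.span {a})
    (Ideal.span (Set.range f.coeff)) B haI
    (fun h => ha (by have := hcoeff f.natDegree; rw [h] at this; exact this))
    (fun h => ha (by
      have : a ∈ B := (hB a).2 fun i => dvd_mul_left _ _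
      rw [h] at this; simpa using this))
    (by
      rw [Ideal.mul_le]
      intro r hr s hs
      have hle : Ideal.span (Set.range f.coeff) ≤
          Submodule.comap (LinearMap.mulRight D s) (Ideal.span {a}) := by
        rw [Ideal.span_le]
        rintro _ ⟨i, rfl⟩
        simpa [Ideal.mem_span_singleton] using hs i
      simpa using hle hr)
  have hHL_dvd : ∀ h ∈ H, ∀ l ∈ L, a ∣ h * l := fun h hh l hl =>
    (hHL' _ (Ideal.mul_mem_mul hh hl)).dvd ha
  have hLB : ∀ l ∈ L, l ∈ B := fun l hl i => by
    rw [mul_comm]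
    refine (hAH _ (hcoeff i)).dvd_mul ha fun h hh => ?_
    rw [mul_comm]
    exact hHL_dvd h hh l hl
  have hHB : ∀ h ∈ H, ∀ b ∈ B, a ∣ h * b := fun h hh b hb =>
    (hBL b hb).dvd_mul ha fun l hl => hHL_dvd h hh l hl
  obtain ⟨S, hS, hSa⟩ := hHL a (Ideal.mem_span_singleton_self a)
  obtain ⟨T, hTL, hST⟩ := exists_finset_forall_mem_mul_span S hS
  obtain ⟨l₀, hl₀, hl₀'⟩ := Submodule.exists_mem_ne_zero_of_ne_bot hL
  refine hasTInverse_of_finset ha (insert l₀ T) ⟨l₀, by simp, hl₀'⟩ ?_ ?_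
  · intro i s hs
    rcases Finset.mem_insert.1 hs with rfl | hs
    · exact hLB _ hl₀ i
    · exact hLB _ (hTL hs) i
  · intro p q hq hpq
    have hqa : q * a ≠ 0 := mul_ne_zero hq ha
    have hdvd : ∀ h ∈ H, ∀ l ∈ T, q * a ∣ p * (h * l) := by
      intro h hh l hl
      have hl' : ∀ i, q * a ∣ p * (f.coeff i * l) := fun i => hpq i l (Finset.mem_insert_of_mem hl)
      obtain ⟨b, hb⟩ : q ∣ p * l := by
        refine (mul_dvd_mul_iff_right ha).1 ?_
        rw [mul_assoc, mul_comm l]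
        exact hl' f.natDegree
      have hbB : b ∈ B := (hB b).2 fun i => by
        refine (mul_dvd_mul_iff_left hq).1 ?_
        have h1 : q * (f.coeff i * b) = p * (f.coeff i * l) := by
          linear_combination (-f.coeff i) * hb
        rw [h1]
        exact hl' i
      have h1 : p * (h * l) = q * (h * b) := by linear_combination h * hb
      rw [h1]
      exact mul_dvd_mul_left q (hHB h hh b hbB)
    refine (mul_dvd_mul_iff_right ha).1 (hSa p (q * a) hqa fun y hy => ?_)
    have hle : H * Ideal.span (T : Set D) ≤
        Submodule.comap (LinearMap.mulLeft D p) (Ideal.span {q * a}) := by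
      rw [Ideal.mul_le]
      intro h hh
      have hle : Ideal.span (T : Set D) ≤
          Submodule.comap (LinearMap.mulLeft D (p * h)) (Ideal.span {q * a}) := by
        rw [Ideal.span_le]
        intro l hl
        simpa [Ideal.mem_span_singleton, mul_assoc] using hdvd h hh l hl
      intro l hl
      simpa [mul_assoc] using hle hl
    simpa [Ideal.mem_span_singleton] using hle (hST hy)

/-- In a sharp domain, `c` times the inverse of the ideal generated by `X ∋ c` is generated, up to
`v`-closure of the product, by finitely many elements. -/
lemma IsSharpDomain.exists_finset {R : Type*} [CommRing R] [IsDomain R] (hR : IsSharpDomain R)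
    {X : Set R} {c : R} (hc : c ≠ 0) (hcX : c ∈ X) :
    ∃ T : Finset R, (∃ t ∈ T, t ≠ 0) ∧ (∀ x ∈ X, ∀ t ∈ T, c ∣ x * t) ∧
      ∀ p q : R, q ≠ 0 → (∀ x ∈ X, ∀ t ∈ T, q * c ∣ p * (x * t)) → q ∣ p := by
  classical
  let B : Ideal R :=
    { carrier := {y | ∀ x ∈ X, c ∣ x * y}
      add_mem' := fun hy hz x hx => by rw [mul_add]; exact dvd_add (hy x hx) (hz x hx)
      zero_mem' := fun x _ => by simp
      smul_mem' := fun r y hy x hx => by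
        rw [smul_eq_mul, mul_left_comm]
        exact (hy x hx).mul_left r }
  have hB : ∀ y, y ∈ B ↔ ∀ x ∈ X, c ∣ x * y := fun _ => Iff.rfl
  have hcB : c ∈ B := (hB c).2 fun _ _ => dvd_mul_left _ _
  obtain ⟨A', B', hA, hB', heq⟩ := hR (Ideal.span {c}) (Ideal.span X) B (by simpa using hc)
    (fun h => hc (by have := Ideal.subset_span (α := R) hcX; rw [h] at this; simpa using this))
    (fun h => hc (by rw [h] at hcB; simpa using hcB))
    (by
      rw [Ideal.mul_le]
      intro r hr s hs
      have hle : Ideal.span X ≤ Submodule.comap (LinearMap.mulRight R s) (Ideal.span {c}) := by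
        rw [Ideal.span_le]
        intro x hx
        simpa [Ideal.mem_span_singleton] using hs x hx
      simpa using hle hr)
  have hAB : ∀ y ∈ A', ∀ z ∈ B', c ∣ y * z := fun y hy z hz => by
    rw [← Ideal.mem_span_singleton, heq]
    exact Ideal.mul_mem_mul hy hz
  have hBB : ∀ y ∈ B', y ∈ B := fun y hy x hx => hAB x (hA (Ideal.subset_span hx)) y hy
  obtain ⟨T, hT, hcT⟩ := exists_finset_forall_mem_mul_span (A := A') (B := B') {c}
    (by simp [← heq])
  replace hcT : c ∈ A' * Ideal.span (T : Set R) := hcT (by simp)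
  refine ⟨insert c T, ⟨c, by simp, hc⟩, ?_, fun p q hq hpq => ?_⟩
  · intro x hx t ht
    rcases Finset.mem_insert.1 ht with rfl | ht
    · exact dvd_mul_left _ _
    · exact hBB t (hT ht) x hx
  have hdvd : ∀ y ∈ A', ∀ t ∈ T, q * c ∣ p * (y * t) := by
    intro y hy t ht
    have ht' : ∀ x ∈ X, q * c ∣ p * (x * t) := fun x hx => hpq x hx t (Finset.mem_insert_of_mem ht)
    obtain ⟨b, hb⟩ : q ∣ p * t := by
      refine (mul_dvd_mul_iff_right hc).1 ?_
      rw [mul_assoc, mul_comm t]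
      exact ht' c hcX
    have hbB : b ∈ B := (hB b).2 fun x hx => by
      refine (mul_dvd_mul_iff_left hq).1 ?_
      have h1 : q * (x * b) = p * (x * t) := by linear_combination (-x) * hb
      rw [h1]
      exact ht' x hx
    have h1 : p * (y * t) = q * (y * b) := by linear_combination y * hb
    rw [h1]
    exact mul_dvd_mul_left q (hAB y hy b (hB' hbB))
  have hle : A' * Ideal.span (T : Set R) ≤
      Submodule.comap (LinearMap.mulLeft R p) (Ideal.span {q * c}) := by
    rw [Ideal.mul_le]
    intro y hy
    have hle : Ideal.span (T : Set R) ≤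
        Submodule.comap (LinearMap.mulLeft R (p * y)) (Ideal.span {q * c}) := by
      rw [Ideal.span_le]
      intro t ht
      simpa [Ideal.mem_span_singleton, mul_assoc] using hdvd y hy t ht
    intro t ht
    simpa [mul_assoc] using hle ht
  refine (mul_dvd_mul_iff_right hc).1 ?_
  simpa [Ideal.mem_span_singleton] using hle hcT

end Sharp

section Transfer

open Polynomial

variable {D : Type*} [CommRing D] [IsDomain D] {N : Submonoid D[X]} {R : Type*} [CommRing R]
  [Algebra D[X] R] [IsLocalization N R]

lemma algebraMap_polynomial_injective
    (hN : ∀ h : D[X], h ∈ N ↔ h ≠ 0 ∧ InVClosure (Set.range h.coeff) 1) :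
    Function.Injective (algebraMap D[X] R) :=
  IsLocalization.injective R fun h hh => mem_nonZeroDivisors_of_ne_zero ((hN h).1 hh).1

variable [IsDomain R]

/-- If `D[X]_{N_v}` is sharp, then contents are `t`-invertible in `D`. -/
lemma hasTInverse_of_isSharpDomain
    (hN : ∀ h : D[X], h ∈ N ↔ h ≠ 0 ∧ InVClosure (Set.range h.coeff) 1)
    (hR : IsSharpDomain R) {f : D[X]} (hf : f ≠ 0) : HasTInverse f := by
  classical
  have hinj : Function.Injective (algebraMap D[X] R) := algebraMap_polynomial_injective hN
  let a := f.leadingCoeff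
  have ha : a ≠ 0 := leadingCoeff_ne_zero.2 hf
  have hc : algebraMap D[X] R (C a) ≠ 0 := by
    rw [Ne, map_eq_zero_iff _ hinj, C_eq_zero]
    exact ha
  obtain ⟨T, ⟨t₀, ht₀, ht₀'⟩, hdvd, hv⟩ := hR.exists_finset
    (X := Set.range fun i => algebraMap D[X] R (C (f.coeff i))) hc ⟨f.natDegree, rfl⟩
  obtain ⟨b, hb⟩ := IsLocalization.exist_integer_multiples_of_finset N T
  have hr : ∀ (i : ℕ) (t : R), ∃ r, t ∈ T →
      algebraMap D[X] R (C (f.coeff i)) * t = algebraMap D[X] R (C a) * r := by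
    intro i t
    by_cases ht : t ∈ T
    · obtain ⟨r, hr⟩ := hdvd _ ⟨i, rfl⟩ t ht
      exact ⟨r, fun _ => hr⟩
    · exact ⟨0, fun h => absurd h ht⟩
  choose r hr using hr
  obtain ⟨s, hs⟩ := IsLocalization.exist_integer_multiples N (f.support ×ˢ T)
    fun x => r x.1 x.2
  have hG : ∀ t : R, ∃ G : D[X], t ∈ T →
      algebraMap D[X] R G = algebraMap D[X] R ((s : D[X]) * b) * t := by
    intro t
    by_cases ht : t ∈ T
    · obtain ⟨g, hg⟩ := hb t ht
      rw [Algebra.smul_def] at hg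
      exact ⟨s * g, fun _ => by rw [map_mul, hg, map_mul, mul_assoc]⟩
    · exact ⟨0, fun h => absurd h ht⟩
  choose G hG using hG
  have hunit : IsUnit (algebraMap D[X] R ((s : D[X]) * b)) := IsLocalization.map_units R (s * b)
  have hGdvd : ∀ i, ∀ t ∈ T, C a ∣ C (f.coeff i) * G t := by
    intro i t ht
    by_cases hi : f.coeff i = 0
    · simp [hi]
    obtain ⟨u, hu⟩ := hs (i, t) (Finset.mem_product.2 ⟨mem_support_iff.2 hi, ht⟩)
    rw [Algebra.smul_def] at hu
    refine ⟨b * u, hinj ?_⟩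
    rw [map_mul, map_mul, map_mul, hG t ht, hu, map_mul]
    linear_combination (algebraMap D[X] R s * algebraMap D[X] R b) * hr i t ht
  have hG₀ : G t₀ ≠ 0 := by
    intro h
    have := hG t₀ ht₀
    rw [h, map_zero, eq_comm] at this
    exact mul_ne_zero hunit.ne_zero ht₀' this
  refine hasTInverse_of_finset ha (T.biUnion fun t => (G t).coeffs)
    ⟨(G t₀).leadingCoeff, ?_, ?_⟩ ?_ ?_
  · exact Finset.mem_biUnion.2 ⟨t₀, ht₀, mem_coeffs_iff.2
      ⟨_, natDegree_mem_support_of_nonzero hG₀, rfl⟩⟩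
  · exact leadingCoeff_ne_zero.2 hG₀
  · intro i y hy
    obtain ⟨t, ht, hy⟩ := Finset.mem_biUnion.1 hy
    obtain ⟨n, -, rfl⟩ := mem_coeffs_iff.1 hy
    simpa using (C_dvd_iff_dvd_coeff _ _).1 (hGdvd i t ht) n
  · intro p q hq hpq
    have hq' : algebraMap D[X] R (C q) ≠ 0 := by
      rwa [Ne, map_eq_zero_iff _ hinj, C_eq_zero]
    obtain ⟨w, hw⟩ : algebraMap D[X] R (C q) ∣ algebraMap D[X] R (C p) := by
      refine hv _ _ hq' ?_
      rintro _ ⟨i, rfl⟩ t ht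
      have h1 : C (q * a) ∣ C p * (C (f.coeff i) * G t) := by
        rw [C_dvd_iff_dvd_coeff]
        intro n
        rw [coeff_C_mul, coeff_C_mul]
        by_cases hn : (G t).coeff n = 0
        · simp [hn]
        exact hpq i _ (Finset.mem_biUnion.2
          ⟨t, ht, mem_coeffs_iff.2 ⟨n, mem_support_iff.2 hn, rfl⟩⟩)
      have h2 := map_dvd (algebraMap D[X] R) h1
      rw [C_mul, map_mul, map_mul, map_mul, hG t ht] at h2
      change _ ∣ _ * (algebraMap D[X] R (C (f.coeff i)) * t)
      rw [← hunit.dvd_mul_right]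
      convert h2 using 1
      ring
    obtain ⟨u, v, rfl⟩ := IsLocalization.exists_mk'_eq N w
    have hpv : C p * (v : D[X]) = C q * u := by
      apply hinj
      rw [map_mul, map_mul, hw, mul_assoc, IsLocalization.mk'_spec]
    rw [← mul_one p]
    refine ((hN v).1 v.2).2 p q hq ?_
    rintro _ ⟨i, rfl⟩
    rw [← coeff_C_mul, hpv, coeff_C_mul]
    exact dvd_mul_right _ _

end Transfer

/-- A domain `D` is `t`-sharp if and only if the ring
`D[X]_{N_v}` is sharp, where `N_v = {f ∈ D[X] ∖ {0} ∣ c(f)_v = D}`. -/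
theorem statement17 (D : Type*) [CommRing D] [IsDomain D]
    (K : Type*) [Field K] [Algebra D K] [IsFractionRing D K]
    (N : Submonoid (Polynomial D))
    (hN : ∀ f : Polynomial D,
      f ∈ N ↔ f ≠ 0 ∧ vOp ((polyContent f : Ideal D) : FractionalIdeal D⁰ K) = 1)
    (R : Type*) [CommRing R] [IsDomain R] [Algebra (Polynomial D) R] [IsLocalization N R] :
    IsSharpOp (D := D) (K := K) tOp ↔ IsSharpDomain R := by
  replace hN : ∀ h : Polynomial D, h ∈ N ↔ h ≠ 0 ∧ InVClosure (Set.range h.coeff) 1 := fun h =>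
    (hN h).trans (and_congr_right fun hh => vOp_polyContent_eq_one_iff hh)
  have hinj : Function.Injective (algebraMap (Polynomial D) R) :=
    algebraMap_polynomial_injective hN
  have hN₁ := fun h hh => ((hN h).1 hh).2
  have hN₂ := fun h hh hh' => (hN h).2 ⟨hh, hh'⟩
  let ext : Ideal D → Ideal R := fun I =>
    (I.map Polynomial.C).map (algebraMap (Polynomial D) R)
  let con : Ideal R → Ideal D := fun J =>
    (J.comap (algebraMap (Polynomial D) R)).comap Polynomial.C
  have hext_mul : ∀ I J, ext (I * J) = ext I * ext J := fun I J => by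
    simp only [ext, Ideal.map_mul]
  have hext_le : ∀ I J, ext I ≤ J ↔ I ≤ con J := fun I J => by
    simp only [ext, con, Ideal.map_le_iff_le_comap]
  have hext_ne : ∀ I, I ≠ 0 → ext I ≠ 0 := fun I hI h => hI <| by
    refine le_bot_iff.1 fun x hx => ?_
    have h0 : algebraMap (Polynomial D) R (Polynomial.C x) ∈ (0 : Ideal R) :=
      h ▸ (hext_le I (ext I)).1 le_rfl hx
    rwa [Ideal.zero_eq_bot, Ideal.mem_bot, map_eq_zero_iff _ hinj, Polynomial.C_eq_zero] at h0
  rw [isSharpOp_tOp_iff]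
  constructor
  · intro hD I A B hI hA hB hAB
    have hinv : ∀ f : Polynomial D, f ≠ 0 → HasTInverse f := fun f => hasTInverse_of_tSharp hD
    have hself : ∀ J, ext (con J) = J := map_comap_eq_self hN₂ hinv
    have hcon_ne : ∀ J, J ≠ 0 → con J ≠ 0 := fun J hJ h => hJ <| by
      rw [← hself J, h]
      simp [ext]
    have hclosure : ∀ {I J : Ideal D}, J ≠ 0 → (∀ x ∈ I, InTClosure J x) → ext I ≤ ext J :=
      fun hJ h => (hext_le _ _).2 fun x hx => mem_map_of_inTClosure hN₂ hinv hJ (h x hx)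
    obtain ⟨H, J, hH, hJ, h₁, h₂, hAH, hBJ⟩ := hD (con I) (con A) (con B) (hcon_ne I hI)
      (hcon_ne A hA) (hcon_ne B hB) (by
        rw [← hext_le, hext_mul, hself, hself]
        exact hAB)
    refine ⟨ext H, ext J, ?_, ?_, ?_⟩
    · exact (hself A).ge.trans (hclosure hH hAH)
    · exact (hself B).ge.trans (hclosure hJ hBJ)
    · rw [← hext_mul, ← hself I]
      exact le_antisymm (hclosure (mul_ne_zero hH hJ) h₁) (hclosure (hcon_ne I hI) h₂)
  · intro hR I A B hI hA hB hAB
    have hself : ∀ J, ext (con J) = J :=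
      map_comap_eq_self hN₂ fun f => hasTInverse_of_isSharpDomain hN hR
    obtain ⟨A', B', hA', hB', h⟩ := hR (ext I) (ext A) (ext B) (hext_ne I hI) (hext_ne A hA)
      (hext_ne B hB) (by
        rw [← hext_mul]
        exact Ideal.map_mono (Ideal.map_mono hAB))
    rw [hext_le] at hA' hB'
    have hIext : ext (con A' * con B') = ext I := by rw [hext_mul, hself, hself, h]
    refine ⟨con A', con B', ne_bot_of_le_ne_bot hA hA', ne_bot_of_le_ne_bot hB hB',
      fun x hx => ?_, fun x hx => ?_, fun x hx => InTClosure.of_mem (hA' hx),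
      fun x hx => InTClosure.of_mem (hB' hx)⟩
    · exact inTClosure_of_mem_map hN₁ ((hext_le _ _).1 hIext.ge hx)
    · exact inTClosure_of_mem_map hN₁ ((hext_le _ _).1 hIext.le hx)
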